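/- Let n ≥ 1 and let F, G be Hermitian n×n complex matrices such that F+G is invertible, and set M = (F+G)⁻¹. For any vectors a, c ∈ ℂⁿ put u = M(Ga + c) and v = M(Fa − c). Then u* F u + v* G v = a* (F·M·G) a + c* M c, where for a matrix N and vectors x, y the scalar x* N y denotes Σ_{p,q} conj(x_p) N_{pq} y_q. -/

import Mathlib

/-- the pointwise matrix identity underlying the mean-square error
formula (55): with `M = (F+G)⁻¹`, `u = M(Ga + c)`, `v = M(Fa − c)`, one has
`u* F u + v* G v = a* (F·M·G) a + c* M c`. -/
theorem stmt_0 (n : ℕ) (hn : 1 ≤ n)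
    (F G : Matrix (Fin n) (Fin n) ℂ)
    (hF : F.IsHermitian) (hG : G.IsHermitian)
    (hinv : IsUnit (F + G))
    (M : Matrix (Fin n) (Fin n) ℂ) (hM : M = (F + G)⁻¹)
    (a c u v : Fin n → ℂ)
    (hu : u = M.mulVec (G.mulVec a + c))
    (hv : v = M.mulVec (F.mulVec a - c)) :
    (∑ p, ∑ q, (starRingEnd ℂ) (u p) * F p q * u q) +
      (∑ p, ∑ q, (starRingEnd ℂ) (v p) * G p q * v q) =
    (∑ p, ∑ q, (starRingEnd ℂ) (a p) * (F * M * G) p q * a q) +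
      (∑ p, ∑ q, (starRingEnd ℂ) (c p) * M p q * c q) := by
  have key : ∀ (N : Matrix (Fin n) (Fin n) ℂ) (x : Fin n → ℂ),
      (∑ p, ∑ q, (starRingEnd ℂ) (x p) * N p q * x q) = star x ⬝ᵥ (N.mulVec x) := by
    intro N x
    simp [dotProduct, Matrix.mulVec, Finset.mul_sum, mul_assoc]
  have hdet : IsUnit (F + G).det := (Matrix.isUnit_iff_isUnit_det _).1 hinv
  have h1 : M * (F + G) = 1 := by rw [hM]; exact Matrix.nonsing_inv_mul _ hdet
  have h2 : (F + G) * M = 1 := by rw [hM]; exact Matrix.mul_nonsing_inv _ hdet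
  have hMH : M.IsHermitian := by rw [hM]; exact (hF.add hG).inv
  have adj : ∀ (N : Matrix (Fin n) (Fin n) ℂ), N.IsHermitian → ∀ x y : Fin n → ℂ,
      star (N.mulVec x) ⬝ᵥ y = star x ⬝ᵥ N.mulVec y := by
    intro N hN x y
    rw [Matrix.star_mulVec, hN.eq, Matrix.dotProduct_mulVec]
  have hcomm : F * M * G = G * M * F := by
    have e1 : F * M = 1 - G * M := by rw [← h2, add_mul]; abel
    have e2 : M * F = 1 - M * G := by rw [← h1, mul_add]; abel
    rw [e1, mul_assoc G M F, e2, sub_mul, mul_sub, one_mul, mul_one, mul_assoc]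
  have huv : u + v = a := by
    rw [hu, hv, ← Matrix.mulVec_add]
    have : G.mulVec a + c + (F.mulVec a - c) = (F + G).mulVec a := by
      rw [Matrix.add_mulVec]; abel
    rw [this, Matrix.mulVec_mulVec, h1, Matrix.one_mulVec]
  have hFu : F.mulVec u = G.mulVec v + c := by
    have e : (F + G).mulVec u = G.mulVec a + c := by
      rw [hu, Matrix.mulVec_mulVec, h2, Matrix.one_mulVec]
    rw [← huv, Matrix.add_mulVec, Matrix.mulVec_add] at e
    have := congrArg (fun w => w - G.mulVec u) e
    simp only [add_sub_cancel_right] at this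
    rw [this]; abel
  rw [key, key, key, key, hFu, hcomm]
  have s1 : star u ⬝ᵥ (G.mulVec v + c) + star v ⬝ᵥ G.mulVec v
      = star a ⬝ᵥ G.mulVec v + star u ⬝ᵥ c := by
    rw [← huv, star_add, add_dotProduct, dotProduct_add]; ring
  have s2 : star u ⬝ᵥ c = star a ⬝ᵥ G.mulVec (M.mulVec c) + star c ⬝ᵥ M.mulVec c := by
    rw [hu, adj M hMH, star_add, add_dotProduct, adj G hG]
  rw [s1, s2, hv, Matrix.mulVec_sub, Matrix.mulVec_sub, dotProduct_sub,
    Matrix.mulVec_mulVec, Matrix.mulVec_mulVec, Matrix.mulVec_mulVec, mul_assoc]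
  ring
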